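/- Every Eberlein–Grothendieck scattered space that is K-analytic, as well as every Eberlein–Grothendieck scattered space that is cosmic, is σ-discrete. -/

import Mathlib

open Set Topology Ordinal Cardinal

noncomputable section
universe u

/-- A topological space is *scattered* if every nonempty subset has a point isolated
in the subspace topology, i.e. there is an open set meeting the subset in exactly
that point. -/
def IsScattered (X : Type*) [TopologicalSpace X] : Prop :=
  ∀ S : Set X, S.Nonempty → ∃ x ∈ S, ∃ U : Set X, IsOpen U ∧ U ∩ S = {x}

/-- A space is *meta-Lindelöf* if every open cover has a point-countable open refinement. -/
def IsMetaLindelof (X : Type*) [TopologicalSpace X] : Prop :=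
  ∀ 𝒰 : Set (Set X), (∀ U ∈ 𝒰, IsOpen U) → ⋃₀ 𝒰 = Set.univ →
    ∃ 𝒱 : Set (Set X), (∀ V ∈ 𝒱, IsOpen V) ∧ ⋃₀ 𝒱 = Set.univ ∧
      (∀ V ∈ 𝒱, ∃ U ∈ 𝒰, V ⊆ U) ∧ ∀ x : X, {V ∈ 𝒱 | x ∈ V}.Countable

/-- A space is *hereditarily meta-Lindelöf* if every subspace is meta-Lindelöf. -/
def HereditarilyMetaLindelof (X : Type*) [TopologicalSpace X] : Prop :=
  ∀ S : Set X, IsMetaLindelof S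

/-- A space is *σ-discrete* if it is a countable union of subspaces, each of which is
discrete in its subspace topology. -/
def IsSigmaDiscrete (X : Type*) [TopologicalSpace X] : Prop :=
  ∃ D : ℕ → Set X, (⋃ n, D n) = Set.univ ∧ ∀ n, DiscreteTopology (D n)

/-- The Cantor–Bendixson derivatives `cbDeriv X α = X^(α)`: for each `β < α` we intersect
the set of non-isolated points of `X^(β)`.  This agrees with the usual transfinite
iteration: `X^(0) = X`, `X^(α+1)` is the set of non-isolated points of `X^(α)`, and at
limit ordinals one takes intersections. -/
def cbDeriv (X : Type*) [TopologicalSpace X] (o : Ordinal) : Set X :=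
  ⋂ p : {b : Ordinal // b < o},
    (cbDeriv X p.1 ∩ {x | x ∈ closure (cbDeriv X p.1 \ {x})})
termination_by o
decreasing_by exact p.2

/-- The Cantor–Bendixson height of a space: the least ordinal `α` with `X^(α) = ∅`. -/
def cbHeight (X : Type*) [TopologicalSpace X] : Ordinal :=
  sInf {o : Ordinal | cbDeriv X o = ∅}

/-- A space `X` is *Eberlein–Grothendieck* if it embeds into `C_p(K)`, the space of
continuous real-valued functions on a compact Hausdorff space `K` with the topology of
pointwise convergence (the subspace topology from the product topology on `K → ℝ`). -/
def EberleinGrothendieck (X : Type u) [TopologicalSpace X] : Prop :=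
  ∃ (K : Type u) (_ : TopologicalSpace K), CompactSpace K ∧ T2Space K ∧
    ∃ f : X → {g : K → ℝ // Continuous g}, IsEmbedding f

/-- The weight of a topological space: the least cardinality of a base for the topology. -/
def tweight (X : Type u) [TopologicalSpace X] : Cardinal.{u} :=
  sInf {c : Cardinal.{u} | ∃ B : Set (Set X), TopologicalSpace.IsTopologicalBasis B ∧ #B = c}

/-- A space is *locally countable* if every point has a countable open neighborhood. -/
def LocallyCountable (X : Type*) [TopologicalSpace X] : Prop :=
  ∀ x : X, ∃ U : Set X, IsOpen U ∧ x ∈ U ∧ U.Countable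

/-- A Tychonoff space `X` is *K-analytic* if there is an upper semicontinuous map `F`
from the Baire space `ℕ → ℕ` to the nonempty compact subsets of `X` whose union is all
of `X`. -/
def IsKAnalytic (X : Type*) [TopologicalSpace X] : Prop :=
  ∃ F : (ℕ → ℕ) → Set X,
    (∀ s, (F s).Nonempty ∧ IsCompact (F s)) ∧
    (∀ s : ℕ → ℕ, ∀ W : Set X, IsOpen W → F s ⊆ W →
      ∃ V : Set (ℕ → ℕ), IsOpen V ∧ s ∈ V ∧ ∀ s' ∈ V, F s' ⊆ W) ∧
    (⋃ s, F s) = Set.univ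

/-- A space is *cosmic* if it has a countable network. -/
def IsCosmic (X : Type*) [TopologicalSpace X] : Prop :=
  ∃ N : Set (Set X), N.Countable ∧
    ∀ x : X, ∀ U : Set X, IsOpen U → x ∈ U → ∃ s ∈ N, x ∈ s ∧ s ⊆ U

/-- A separately continuous pairing `φ` between `K` and `X` together with a finitary closure
system on `Z`: every `T : Set Z` generates `A T ⊆ X` and `B T ⊆ K`, a retraction `r T` of `X` onto
the closure of `A T` preserving the values on `B T`, and dually a retraction `ρ T` of `K`. -/
structure RetractionSystem {X K : Type*} [TopologicalSpace X] [TopologicalSpace K]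
    (φ : K → X → ℝ) (Z : Type*) where
  isEmbedding : IsEmbedding fun x k => φ k x
  continuous_left : ∀ x, Continuous fun k => φ k x
  A : Set Z → Set X
  B : Set Z → Set K
  A_mono : Monotone A
  B_mono : Monotone B
  exists_mem_A : ∀ {𝒯 : Set (Set Z)}, 𝒯.Nonempty → DirectedOn (· ⊆ ·) 𝒯 →
    ∀ {a}, a ∈ A (⋃₀ 𝒯) → ∃ T ∈ 𝒯, a ∈ A T
  exists_mem_B : ∀ {𝒯 : Set (Set Z)}, 𝒯.Nonempty → DirectedOn (· ⊆ ·) 𝒯 →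
    ∀ {b}, b ∈ B (⋃₀ 𝒯) → ∃ T ∈ 𝒯, b ∈ B T
  countable_A : ∀ {T : Set Z}, T.Countable → (A T).Countable
  r : Set Z → X → X
  r_mem : ∀ T x, r T x ∈ closure (A T)
  r_eq : ∀ T x, ∀ b ∈ B T, φ b (r T x) = φ b x
  ρ : Set Z → K → K
  ρ_mem : ∀ T k, ρ T k ∈ closure (B T)
  ρ_eq : ∀ T k, ∀ a ∈ A T, φ (ρ T k) a = φ k a

namespace RetractionSystem

variable {X K Z : Type*} [TopologicalSpace X] [TopologicalSpace K] {φ : K → X → ℝ}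

theorem continuous_right (R : RetractionSystem φ Z) (k : K) : Continuous (φ k) :=
  (continuous_apply k).comp R.isEmbedding.continuous

variable (R : RetractionSystem φ Z)

theorem eq_of_agree_A {T : Set Z} {k k' : K} (h : ∀ a ∈ R.A T, φ k a = φ k' a) {x : X}
    (hx : x ∈ closure (R.A T)) : φ k x = φ k' x :=
  closure_minimal (t := {x | φ k x = φ k' x}) h
    (isClosed_eq (R.continuous_right k) (R.continuous_right k')) hx

theorem eq_of_agree_B {T : Set Z} {x y : X} (h : ∀ b ∈ R.B T, φ b x = φ b y) {k : K}
    (hk : k ∈ closure (R.B T)) : φ k x = φ k y :=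
  closure_minimal (t := {k | φ k x = φ k y}) h
    (isClosed_eq (R.continuous_left x) (R.continuous_left y)) hk

theorem apply_r (T : Set Z) (k : K) (x : X) : φ k (R.r T x) = φ (R.ρ T k) x :=
  (R.eq_of_agree_A (fun a ha => (R.ρ_eq T k a ha).symm) (R.r_mem T x)).trans
    (R.eq_of_agree_B (R.r_eq T x) (R.ρ_mem T k))

theorem continuous_r (T : Set Z) : Continuous (R.r T) := by
  rw [R.isEmbedding.continuous_iff, continuous_pi_iff]
  intro k
  simpa only [Function.comp_apply, R.apply_r] using R.continuous_right (R.ρ T k)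

theorem r_unique {T : Set Z} {x y : X} (hy : y ∈ closure (R.A T))
    (h : ∀ b ∈ R.B T, φ b y = φ b x) : R.r T x = y := by
  apply R.isEmbedding.injective
  funext k
  change φ k (R.r T x) = φ k y
  rw [R.apply_r, ← R.eq_of_agree_B h (R.ρ_mem T k)]
  exact R.eq_of_agree_A (R.ρ_eq T k) hy

theorem r_of_mem {T : Set Z} {x : X} (hx : x ∈ closure (R.A T)) : R.r T x = x :=
  R.r_unique hx fun _ _ => rfl

/-- The function `x` oscillates by at most `η` on each fibre of the restriction to `A T`. -/
def OscLE (T : Set Z) (η : ℝ) (x : X) : Prop :=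
  ∀ k k', (∀ a ∈ R.A T, φ k a = φ k' a) → |φ k x - φ k' x| ≤ η

variable {R} in
theorem OscLE.mono {T T' : Set Z} {η : ℝ} {x : X} (h : R.OscLE T η x) (hT : T ⊆ T') :
    R.OscLE T' η x :=
  fun k k' hk => h k k' fun a ha => hk a (R.A_mono hT ha)

variable {R} in
theorem OscLE.abs_sub_le {T : Set Z} {η : ℝ} {x : X} (h : R.OscLE T η x) (k : K) :
    |φ k (R.r T x) - φ k x| ≤ η := by
  rw [R.apply_r]
  exact h _ _ (R.ρ_eq T k)

theorem exists_oscLE [CompactSpace K] {𝒯 : Set (Set Z)} (hne : 𝒯.Nonempty)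
    (hd : DirectedOn (· ⊆ ·) 𝒯) {x : X} (hx : x ∈ closure (R.A (⋃₀ 𝒯))) {η : ℝ} (hη : 0 < η) :
    ∃ T ∈ 𝒯, R.OscLE T η x := by
  by_contra! hcon
  have := hne.to_subtype
  let C : 𝒯 → Set (K × K) := fun T =>
    {p | (∀ a ∈ R.A T, φ p.1 a = φ p.2 a) ∧ η ≤ |φ p.1 x - φ p.2 x|}
  have hfst (y : X) : Continuous fun p : K × K => φ p.1 y := (R.continuous_left y).comp continuous_fst
  have hsnd (y : X) : Continuous fun p : K × K => φ p.2 y := (R.continuous_left y).comp continuous_snd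
  have hclosed (T : 𝒯) : IsClosed (C T) := by
    refine IsClosed.inter (s₁ := {p : K × K | ∀ a ∈ R.A T, φ p.1 a = φ p.2 a}) ?_ ?_
    · have : {p : K × K | ∀ a ∈ R.A T, φ p.1 a = φ p.2 a} =
          ⋂ a ∈ R.A T, {p : K × K | φ p.1 a = φ p.2 a} := by
        ext p; simp
      rw [this]
      exact isClosed_biInter fun a _ => isClosed_eq (hfst a) (hsnd a)
    · exact isClosed_le continuous_const ((hfst x).sub (hsnd x)).abs
  obtain ⟨⟨k, k'⟩, hk⟩ := IsCompact.nonempty_iInter_of_directed_nonempty_isCompact_isClosed C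
    (by
      rintro ⟨S, hS⟩ ⟨T, hT⟩
      obtain ⟨W, hW, hSW, hTW⟩ := hd S hS T hT
      exact ⟨⟨W, hW⟩, fun p hp => ⟨fun a ha => hp.1 a (R.A_mono hSW ha), hp.2⟩,
        fun p hp => ⟨fun a ha => hp.1 a (R.A_mono hTW ha), hp.2⟩⟩)
    (by
      rintro ⟨T, hT⟩
      have := hcon T hT
      simp only [OscLE, not_forall, not_le] at this
      obtain ⟨k, k', h, hlt⟩ := this
      exact ⟨(k, k'), h, hlt.le⟩)
    (fun T => (hclosed T).isCompact) hclosed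
  rw [mem_iInter] at hk
  have heq : φ k x = φ k' x := R.eq_of_agree_A (fun a ha => by
    obtain ⟨T, hT, haT⟩ := R.exists_mem_A hne hd ha
    exact (hk ⟨T, hT⟩).1 a haT) hx
  have : η ≤ |φ k x - φ k' x| := (hk ⟨_, hne.some_mem⟩).2
  rw [heq, _root_.sub_self, abs_zero] at this
  exact absurd hη this.not_gt

/-- The closure of `A T` has a countable family of pairs consisting of a set and a symmetric
relation which is locally full on that set, such that the related points are uniformly close. -/
def HasNetwork (T : Set Z) : Prop :=
  ∃ (D : ℕ → Set X) (E : ℕ → X → X → Prop),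
    (∀ n x y, E n x y → E n y x) ∧
    (∀ n, ∀ x ∈ D n, ∃ O, IsOpen O ∧ x ∈ O ∧ ∀ y ∈ D n, y ∈ O → E n x y) ∧
    ∀ x ∈ closure (R.A T), ∀ η : ℝ, 0 < η →
      ∃ n, x ∈ D n ∧ ∀ y ∈ D n, E n x y → ∀ k, |φ k y - φ k x| ≤ η

theorem HasNetwork.of_countable {T : Set Z} {κ : Type*} [Countable κ] [Nonempty κ]
    (D : κ → Set X) (E : κ → X → X → Prop)
    (hE : ∀ n x y, E n x y → E n y x)
    (hO : ∀ n, ∀ x ∈ D n, ∃ O, IsOpen O ∧ x ∈ O ∧ ∀ y ∈ D n, y ∈ O → E n x y)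
    (hD : ∀ x ∈ closure (R.A T), ∀ η : ℝ, 0 < η →
      ∃ n, x ∈ D n ∧ ∀ y ∈ D n, E n x y → ∀ k, |φ k y - φ k x| ≤ η) :
    R.HasNetwork T := by
  obtain ⟨g, hg⟩ := exists_surjective_nat κ
  refine ⟨D ∘ g, E ∘ g, fun n => hE (g n), fun n => hO (g n), fun x hx η hη => ?_⟩
  obtain ⟨n, hn⟩ := hD x hx η hη
  obtain ⟨m, rfl⟩ := hg n
  exact ⟨m, hn⟩

theorem hasNetwork_of_countable [CompactSpace K] {T : Set Z} (hT : T.Countable) :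
    R.HasNetwork T := by
  have := (R.countable_A hT).to_subtype
  let π : K → R.A T → ℝ := fun k a => φ k a
  have hπ : Continuous π := continuous_pi fun a => R.continuous_left a
  have : CompactSpace (range π) := isCompact_iff_compactSpace.1 (isCompact_range hπ)
  let p : C(K, range π) := ⟨rangeFactorization π, hπ.codRestrict mem_range_self⟩
  have hp : IsQuotientMap p :=
    p.continuous.isClosedMap.isQuotientMap p.continuous rangeFactorization_surjective
  refine HasNetwork.of_countable R (κ := ℕ × ℕ)
    (fun n => {x | ∀ k, |φ k x - TopologicalSpace.denseSeq C(range π, ℝ) n.1 (p k)| ≤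
      1 / ((n.2 : ℝ) + 1)})
    (fun _ _ _ => True) (fun _ _ _ _ => trivial)
    (fun n x _ => ⟨univ, isOpen_univ, mem_univ x, fun _ _ _ => trivial⟩) ?_
  intro x hx η hη
  have hfac : ∀ k k', p k = p k' → φ k x = φ k' x := fun k k' h =>
    R.eq_of_agree_A (fun a ha => congrFun (congrArg Subtype.val h) ⟨a, ha⟩) hx
  let g : C(range π, ℝ) := hp.lift ⟨fun k => φ k x, R.continuous_left x⟩ hfac
  have hg (k : K) : g (p k) = φ k x :=
    DFunLike.congr_fun (hp.lift_comp ⟨fun k => φ k x, R.continuous_left x⟩ hfac) k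
  obtain ⟨m, hm⟩ := exists_nat_one_div_lt (half_pos hη)
  obtain ⟨n, hn⟩ := (TopologicalSpace.denseRange_denseSeq C(range π, ℝ)).exists_dist_lt g
    (Nat.one_div_pos_of_nat (α := ℝ) (n := m))
  refine ⟨(n, m), fun k => ?_, fun y hy _ k => ?_⟩
  · rw [← hg, ← Real.dist_eq]
    exact (ContinuousMap.dist_apply_le_dist _).trans hn.le
  · have h1 := hy k
    have h2 := (ContinuousMap.dist_apply_le_dist (f := g)
      (g := TopologicalSpace.denseSeq C(range π, ℝ) n) (p k)).trans hn.le
    rw [Real.dist_eq, hg] at h2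
    rw [abs_le] at *
    constructor <;> linarith [h1.1, h1.2, h2.1, h2.2]

section WellOrder

variable {ι : Type*} [LinearOrder ι] (e : ι → Z)

theorem image_eq_sUnion {I : Set ι} (hI : IsLowerSet I) :
    e '' I = ⋃₀ ((fun i => e '' Iic i) '' I) := by
  ext z
  simp only [mem_image, sUnion_image, mem_iUnion, mem_Iic, exists_prop]
  exact ⟨fun ⟨i, hi, h⟩ => ⟨i, hi, i, le_rfl, h⟩, fun ⟨i, hi, j, hj, h⟩ => ⟨j, hI hj hi, h⟩⟩

theorem directedOn_image (I : Set ι) :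
    DirectedOn (· ⊆ ·) ((fun i => e '' Iic i) '' I) := by
  rintro _ ⟨i, hi, rfl⟩ _ ⟨j, hj, rfl⟩
  rcases le_total i j with h | h
  · exact ⟨_, ⟨j, hj, rfl⟩, image_mono (Iic_subset_Iic.2 h), subset_rfl⟩
  · exact ⟨_, ⟨i, hi, rfl⟩, subset_rfl, image_mono (Iic_subset_Iic.2 h)⟩

theorem exists_oscLE_Iic [CompactSpace K] {I : Set ι} (hI : IsLowerSet I) (hne : I.Nonempty) {x : X}
    (hx : x ∈ closure (R.A (e '' I))) {η : ℝ} (hη : 0 < η) :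
    ∃ i ∈ I, R.OscLE (e '' Iic i) η x := by
  rw [image_eq_sUnion e hI] at hx
  obtain ⟨_, ⟨i, hi, rfl⟩, h⟩ := R.exists_oscLE (hne.image _) (directedOn_image e I) hx hη
  exact ⟨i, hi, h⟩

theorem exists_mem_B_Iic {I : Set ι} (hI : IsLowerSet I) (hne : I.Nonempty) {b : K}
    (hb : b ∈ R.B (e '' I)) : ∃ i ∈ I, b ∈ R.B (e '' Iic i) := by
  rw [image_eq_sUnion e hI] at hb
  obtain ⟨_, ⟨i, hi, rfl⟩, h⟩ := R.exists_mem_B (hne.image _) (directedOn_image e I) hb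
  exact ⟨i, hi, h⟩

/-- The indices at which the retractions along `e` move `x` by more than `ε`. -/
def jumps (ε : ℝ) (x : X) : Set ι :=
  {i | ∃ k, ε < |φ k (R.r (e '' Iic i) x) - φ k (R.r (e '' Iio i) x)|}

theorem finite_jumps [CompactSpace K] [WellFoundedLT ι] {ε : ℝ} (hε : 0 < ε) (x : X) :
    (R.jumps e ε x).Finite := by
  by_contra hinf
  have hinf : (R.jumps e ε x).Infinite := hinf
  obtain ⟨g, hg | hg⟩ := exists_increasing_or_nonincreasing_subseq (· < ·)
    fun n => (hinf.natEmbedding _ n : ι)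
  · let s : ℕ → ι := fun n => hinf.natEmbedding _ (g n)
    have hs : ∀ m n, m < n → s m < s n := hg
    let I : Set ι := {j | ∃ n, j < s n}
    have hI : IsLowerSet I := fun i j hji ⟨n, hn⟩ => ⟨n, hji.trans_lt hn⟩
    obtain ⟨i, ⟨n, hin⟩, hosc⟩ := R.exists_oscLE_Iic e hI ⟨s 0, 1, hs 0 1 one_pos⟩
      (R.r_mem (e '' I) x) hε
    obtain ⟨k, hk⟩ : s n ∈ R.jumps e ε x := (hinf.natEmbedding _ (g n)).2
    have hle : e '' Iic (s n) ⊆ e '' I :=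
      image_mono fun j (hj : j ≤ s n) => ⟨n + 1, hj.trans_lt (hs n (n + 1) n.lt_succ_self)⟩
    have hlt : e '' Iio (s n) ⊆ e '' I := image_mono fun j hj => ⟨n, hj⟩
    have hval {T : Set Z} (hT : T ⊆ e '' I) :
        φ k (R.r T x) = φ (R.ρ T k) (R.r (e '' I) x) := by
      rw [R.apply_r]
      exact R.eq_of_agree_B (fun b hb => (R.r_eq _ _ b hb).symm)
        (closure_mono (R.B_mono hT) (R.ρ_mem T k))
    rw [hval hle, hval hlt] at hk
    refine hk.not_ge (hosc _ _ fun a ha => ?_)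
    have ha1 : a ∈ R.A (e '' Iio (s n)) :=
      R.A_mono (image_mono fun j (hj : j ≤ i) => hj.trans_lt hin) ha
    rw [R.ρ_eq _ k a ha1, R.ρ_eq _ k a (R.A_mono (image_mono Iio_subset_Iic_self) ha1)]
  · obtain ⟨m, hm⟩ := WellFounded.has_min (wellFounded_lt (α := ι))
      (range fun n => (hinf.natEmbedding _ (g n) : ι)) (range_nonempty _)
    obtain ⟨⟨n, rfl⟩, hmin⟩ := hm
    have h1 := hmin _ ⟨n + 1, rfl⟩
    have h2 := hg n (n + 1) n.lt_succ_self
    have h3 := le_antisymm (not_lt.1 h1) (not_lt.1 h2)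
    have := g.injective ((hinf.natEmbedding _).injective (Subtype.ext h3))
    omega

theorem exists_oscLE_and_ne [CompactSpace K] [WellFoundedLT ι] {x : X}
    (hx : x ∈ closure (R.A (range e))) (hx0 : x ∉ closure (R.A ∅)) {η : ℝ} (hη : 0 < η) :
    ∃ i, R.OscLE (e '' Iic i) η x ∧ R.r (e '' Iic i) x ≠ R.r (e '' Iio i) x := by
  rw [← image_univ] at hx
  have hne : (univ : Set ι).Nonempty := by
    by_contra h
    rw [not_nonempty_iff_eq_empty] at h
    rw [h, image_empty] at hx
    exact hx0 hx
  obtain ⟨i, -, hi⟩ := R.exists_oscLE_Iic e isLowerSet_univ hne hx hη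
  obtain ⟨i₀, hi₀, hmin₀⟩ := WellFounded.has_min (wellFounded_lt (α := ι))
    {i | R.OscLE (e '' Iic i) η x} ⟨i, hi⟩
  have hmove : ∃ j, i₀ ≤ j ∧ R.r (e '' Iic j) x ≠ R.r (e '' Iio i₀) x := by
    by_contra! hcon
    have hagree : ∀ b ∈ R.B (e '' univ), φ b (R.r (e '' Iio i₀) x) = φ b x := by
      intro b hb
      obtain ⟨j, -, hj⟩ := R.exists_mem_B_Iic e isLowerSet_univ hne hb
      rw [← hcon _ (le_max_left i₀ j)]
      exact R.r_eq _ _ b (R.B_mono (image_mono (Iic_subset_Iic.2 (le_max_right i₀ j))) hj)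
    have hfix : x = R.r (e '' Iio i₀) x :=
      (R.r_of_mem hx).symm.trans (R.r_unique (closure_mono (R.A_mono (image_mono (subset_univ _)))
        (R.r_mem _ _)) hagree)
    have hxm : x ∈ closure (R.A (e '' Iio i₀)) := by
      rw [hfix]; exact R.r_mem _ _
    rcases (Iio i₀).eq_empty_or_nonempty with h | h
    · rw [h, image_empty] at hxm
      exact hx0 hxm
    · obtain ⟨j, hj, hosc⟩ := R.exists_oscLE_Iic e (isLowerSet_Iio i₀) h hxm hη
      exact hmin₀ j hosc hj
  obtain ⟨j, ⟨hj, hjne⟩, hmin⟩ := WellFounded.has_min (wellFounded_lt (α := ι)) _ hmove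
  refine ⟨j, OscLE.mono hi₀ (image_mono (Iic_subset_Iic.2 hj)), ?_⟩
  suffices R.r (e '' Iio j) x = R.r (e '' Iio i₀) x by rwa [this]
  rcases hj.eq_or_lt with rfl | hlt
  · rfl
  refine R.r_unique (closure_mono (R.A_mono (image_mono (Iio_subset_Iio hj))) (R.r_mem _ _)) ?_
  intro b hb
  obtain ⟨l, hl, hbl⟩ := R.exists_mem_B_Iic e (isLowerSet_Iio j) ⟨i₀, hlt⟩ hb
  have hstay : R.r (e '' Iic (max i₀ l)) x = R.r (e '' Iio i₀) x := by
    by_contra h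
    exact hmin _ ⟨le_max_left _ _, h⟩ (max_lt hlt hl)
  rw [← hstay]
  exact R.r_eq _ _ b (R.B_mono (image_mono (Iic_subset_Iic.2 (le_max_right i₀ l))) hbl)

theorem exists_isOpen_jumps [CompactSpace K] [WellFoundedLT ι] {ε : ℝ} (hε : 0 < ε) (x : X) :
    ∃ O, IsOpen O ∧ x ∈ O ∧ ∀ y ∈ O, R.jumps e ε x ⊆ R.jumps e ε y := by
  rcases isEmpty_or_nonempty K with hK | hK
  · exact ⟨univ, isOpen_univ, mem_univ x, fun y _ i ⟨k, _⟩ => (hK.false k).elim⟩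
  choose! k hk using fun i (hi : i ∈ R.jumps e ε x) => hi
  refine ⟨⋂ i ∈ R.jumps e ε x,
    {y | ε < |φ (k i) (R.r (e '' Iic i) y) - φ (k i) (R.r (e '' Iio i) y)|}, ?_, ?_, ?_⟩
  · refine (R.finite_jumps e hε x).isOpen_biInter fun i _ => ?_
    have hc (T : Set Z) : Continuous fun y => φ (k i) (R.r T y) :=
      (R.continuous_right (k i)).comp (R.continuous_r T)
    exact isOpen_lt continuous_const ((hc _).sub (hc _)).abs
  · exact mem_iInter₂.2 hk
  · exact fun y hy i hi => ⟨k i, mem_iInter₂.1 hy i hi⟩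

theorem hasNetwork_range [CompactSpace K] [WellFoundedLT ι] (h₀ : R.HasNetwork ∅)
    (h : ∀ i, R.HasNetwork (e '' Iic i)) : R.HasNetwork (range e) := by
  obtain ⟨D₀, E₀, hE₀, hO₀, hD₀⟩ := h₀
  choose D E hE hO hD using h
  have hpos (n : ℕ) : (0 : ℝ) < 1 / ((n : ℝ) + 1) := Nat.one_div_pos_of_nat
  refine HasNetwork.of_countable R (κ := ℕ ⊕ (ℕ × ℕ × ℕ × ℕ))
    (Sum.elim D₀ fun c => {x | ∃ i, IsGreatest (R.jumps e (1 / ((c.1 : ℝ) + 1)) x) i ∧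
      (R.jumps e (1 / ((c.1 : ℝ) + 1)) x).ncard = c.2.1 ∧
      R.OscLE (e '' Iic i) (1 / ((c.2.2.1 : ℝ) + 1)) x ∧ R.r (e '' Iic i) x ∈ D i c.2.2.2})
    (Sum.elim E₀ fun c x y => ∃ i, IsGreatest (R.jumps e (1 / ((c.1 : ℝ) + 1)) x) i ∧
      IsGreatest (R.jumps e (1 / ((c.1 : ℝ) + 1)) y) i ∧
      E i c.2.2.2 (R.r (e '' Iic i) x) (R.r (e '' Iic i) y)) ?_ ?_ ?_
  · rintro (n | c)
    · exact hE₀ n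
    · rintro x y ⟨i, hx, hy, hxy⟩
      exact ⟨i, hy, hx, hE _ _ _ _ hxy⟩
  · rintro (n | c)
    · exact hO₀ n
    · rintro x ⟨i, hi, hcard, -, hDi⟩
      obtain ⟨O, hOo, hxO, hOsub⟩ := R.exists_isOpen_jumps e (hpos c.1) x
      obtain ⟨O', hOo', hxO', hOE⟩ := hO i _ _ hDi
      refine ⟨O ∩ R.r (e '' Iic i) ⁻¹' O', hOo.inter (hOo'.preimage (R.continuous_r _)),
        ⟨hxO, hxO'⟩, ?_⟩
      rintro y ⟨i', hi', hcard', -, hDi'⟩ ⟨hyO, hyO'⟩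
      have heq := Set.eq_of_subset_of_ncard_le (hOsub y hyO) (hcard'.trans hcard.symm).le
        (R.finite_jumps e (hpos c.1) y)
      rw [← heq] at hi'
      obtain rfl := hi.unique hi'
      exact ⟨i, hi, heq ▸ hi, hOE _ hDi' hyO'⟩
  · intro x hx η hη
    by_cases hx0 : x ∈ closure (R.A ∅)
    · obtain ⟨n, hn⟩ := hD₀ x hx0 η hη
      exact ⟨Sum.inl n, hn⟩
    obtain ⟨p, hp⟩ := exists_nat_one_div_lt (show 0 < η / 3 by linarith)
    obtain ⟨i, hosc, hne⟩ := R.exists_oscLE_and_ne e hx hx0 (hpos p)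
    obtain ⟨k, hk⟩ : ∃ k, φ k (R.r (e '' Iic i) x) ≠ φ k (R.r (e '' Iio i) x) := by
      by_contra! hcon
      exact hne (R.isEmbedding.injective (funext hcon))
    obtain ⟨q, hq⟩ := exists_nat_one_div_lt (abs_pos.2 (sub_ne_zero.2 hk))
    have hfin := R.finite_jumps e (hpos q) x
    have hi : i ∈ R.jumps e (1 / ((q : ℝ) + 1)) x := ⟨k, hq⟩
    obtain ⟨j, hj, hjmax⟩ : ∃ j ∈ R.jumps e (1 / ((q : ℝ) + 1)) x,
        ∀ b ∈ R.jumps e (1 / ((q : ℝ) + 1)) x, b ≤ j := exists_max_image _ id hfin ⟨i, hi⟩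
    have hjg : IsGreatest (R.jumps e (1 / ((q : ℝ) + 1)) x) j := ⟨hj, hjmax⟩
    have hoscj := OscLE.mono hosc (image_mono (f := e) (Iic_subset_Iic.2 (hjmax i hi)))
    obtain ⟨n, hn, hclose⟩ := hD j _ (R.r_mem _ x) (η / 3) (by linarith)
    refine ⟨Sum.inr (q, (R.jumps e (1 / ((q : ℝ) + 1)) x).ncard, p, n), ⟨j, hjg, rfl, hoscj, hn⟩, ?_⟩
    rintro y ⟨i₁, hi₁, -, hosc₁, hD₁⟩ ⟨i₂, hi₂, hi₂', hE₂⟩ k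
    obtain rfl := hjg.unique hi₂
    obtain rfl := hi₁.unique hi₂'
    have h1 := hoscj.abs_sub_le k
    have h2 := hosc₁.abs_sub_le k
    have h3 := hclose _ hD₁ hE₂ k
    dsimp only at h2 hp
    rw [abs_le] at *
    constructor <;> linarith [h1.1, h1.2, h2.1, h2.2, h3.1, h3.2]

end WellOrder

theorem hasNetwork [CompactSpace K] (T : Set Z) : R.HasNetwork T := by
  induction hc : #T using WellFoundedLT.induction generalizing T with
  | ind c ih =>
    subst hc
    rcases le_or_gt #T ℵ₀ with hT | hT
    · exact R.hasNetwork_of_countable (le_aleph0_iff_set_countable.1 hT)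
    obtain ⟨f⟩ : Nonempty ((#T).ord.ToType ≃ T) := Cardinal.eq.1 (by simp)
    have hrange : range (fun i => (f i : Z)) = T := by
      rw [range_comp' Subtype.val f, f.range_eq_univ, image_univ, Subtype.range_coe]
    rw [← hrange]
    refine R.hasNetwork_range _ (ih _ ?_ ∅ rfl) fun i => ih _ ?_ _ rfl
    · rw [mk_eq_zero]
      exact aleph0_pos.trans hT
    · refine mk_image_le.trans_lt ?_
      have h1 : #(Iio i) < #T := by simpa using mk_Iio_lt i
      rw [← Iio_insert]
      exact mk_insert_le.trans_lt (add_lt_of_lt hT.le h1 (one_lt_aleph0.trans hT))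

end RetractionSystem

section Closure

variable {X K : Type u}

/-- The union of the values of `F` on the cylinder of sequences which agree with `s` below `n`. -/
def cylinderUnion (F : (ℕ → ℕ) → Set X) (s : ℕ → ℕ) (n : ℕ) : Set X :=
  {y | ∃ t, (∀ i < n, t i = s i) ∧ y ∈ F t}

/-- A language with countably many function symbols: a symbol of arity `n` is a finite sequence
coding a cylinder, `n` rational values and a precision. -/
def approxLanguage : FirstOrder.Language.{0, 0} where
  Functions n := List ℕ × (Fin n → ℚ) × ℕ × Bool
  Relations _ := Empty

instance : Countable (Σ n, approxLanguage.Functions n) := by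
  unfold approxLanguage; infer_instance

/-- The sequence extending a list by zeros. -/
def listSeq (l : List ℕ) (i : ℕ) : ℕ := l.getD i 0

/-- `x` is a point of the given cylinder whose values at the arguments are close to the given
rationals. -/
def ApproxPoint (φ : K → X → ℝ) (F : (ℕ → ℕ) → Set X) {n : ℕ}
    (f : approxLanguage.Functions n) (v : Fin n → X ⊕ K) (x : X) : Prop :=
  x ∈ cylinderUnion F (listSeq f.1) f.1.length ∧
    ∀ j b, v j = Sum.inr b → |φ b x - f.2.1 j| < 1 / ((f.2.2.1 : ℝ) + 1)

/-- The values of `k` at the arguments are close to the given rationals. -/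
def ApproxEval (φ : K → X → ℝ) {n : ℕ}
    (f : approxLanguage.Functions n) (v : Fin n → X ⊕ K) (k : K) : Prop :=
  ∀ j a, v j = Sum.inl a → |φ k a - f.2.1 j| < 1 / ((f.2.2.1 : ℝ) + 1)

open Classical in
/-- The structure on `X ⊕ K` whose function symbols choose approximating points. -/
abbrev approxStructure [Nonempty X] (φ : K → X → ℝ) (F : (ℕ → ℕ) → Set X) :
    approxLanguage.Structure (X ⊕ K) where
  funMap {_} f v :=
    if f.2.2.2 then
      if h : ∃ x, ApproxPoint φ F f v x then Sum.inl h.choose else Sum.inl (Classical.arbitrary X)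
    else
      if h : ∃ k, ApproxEval φ f v k then Sum.inr h.choose else Sum.inl (Classical.arbitrary X)
  RelMap {_} r := r.elim

/-- A set closed under the operations of `approxStructure` contains points of any cylinder around
`s` approximating a point of `F s` at finitely many of its elements. -/
theorem exists_approxPoint [Nonempty X] (φ : K → X → ℝ) (F : (ℕ → ℕ) → Set X) (G : Set (X ⊕ K))
    (hG : ∀ {n} (f : approxLanguage.Functions n) (v : Fin n → X ⊕ K), (∀ j, v j ∈ G) →
      (approxStructure φ F).funMap f v ∈ G)
    {s : ℕ → ℕ} {x : X} (hx : x ∈ F s) (N : ℕ) (t : Finset K) (ht : ∀ b ∈ t, Sum.inr b ∈ G)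
    {ε : ℝ} (hε : 0 < ε) :
    ∃ a, Sum.inl a ∈ G ∧ a ∈ cylinderUnion F s N ∧ ∀ b ∈ t, |φ b a - φ b x| < ε := by
  obtain ⟨m, hm⟩ := exists_nat_one_div_lt (half_pos hε)
  have hpos : (0 : ℝ) < 1 / ((m : ℝ) + 1) := Nat.one_div_pos_of_nat
  have hq (b : K) : ∃ q : ℚ, |φ b x - q| < 1 / ((m : ℝ) + 1) := exists_rat_near _ hpos
  choose q hq using hq
  let g : Fin t.card ≃ t := t.equivFin.symm
  let f : approxLanguage.Functions t.card :=
    ((List.range N).map s, fun j => q (g j), m, true)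
  let v : Fin t.card → X ⊕ K := fun j => Sum.inr (g j : K)
  have hseq : ∀ i < N, listSeq ((List.range N).map s) i = s i := by
    intro i hi
    simp [listSeq, List.getD, hi]
  have hex : ∃ y, ApproxPoint φ F f v y := by
    refine ⟨x, ⟨s, ?_, hx⟩, ?_⟩
    · intro i hi
      exact (hseq i (by simpa [f] using hi)).symm
    · intro j b hb
      obtain rfl : (g j : K) = b := Sum.inr_injective hb
      exact hq _
  have hmem := hG f v fun j => ht _ (g j).2
  have hval : (approxStructure φ F).funMap f v = Sum.inl hex.choose :=
    (if_pos rfl).trans (dif_pos hex)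
  rw [hval] at hmem
  obtain ⟨⟨s', hs', hy⟩, hb⟩ := hex.choose_spec
  refine ⟨_, hmem, ⟨s', fun i hi => ?_, hy⟩, fun b hbt => ?_⟩
  · rw [hs' i (by simpa [f] using hi)]
    exact hseq i hi
  · have h1 := hb (g.symm ⟨b, hbt⟩) b (by simp [v])
    have h2 := hq b
    simp only [f, Equiv.apply_symm_apply] at h1
    rw [abs_lt] at *
    constructor <;> linarith [h1.1, h1.2, h2.1, h2.2]

theorem exists_approxEval [Nonempty X] (φ : K → X → ℝ) (F : (ℕ → ℕ) → Set X) (G : Set (X ⊕ K))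
    (hG : ∀ {n} (f : approxLanguage.Functions n) (v : Fin n → X ⊕ K), (∀ j, v j ∈ G) →
      (approxStructure φ F).funMap f v ∈ G)
    (k : K) (t : Finset X) (ht : ∀ a ∈ t, Sum.inl a ∈ G) {ε : ℝ} (hε : 0 < ε) :
    ∃ b, Sum.inr b ∈ G ∧ ∀ a ∈ t, |φ b a - φ k a| < ε := by
  obtain ⟨m, hm⟩ := exists_nat_one_div_lt (half_pos hε)
  have hpos : (0 : ℝ) < 1 / ((m : ℝ) + 1) := Nat.one_div_pos_of_nat
  have hq (a : X) : ∃ q : ℚ, |φ k a - q| < 1 / ((m : ℝ) + 1) := exists_rat_near _ hpos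
  choose q hq using hq
  let g : Fin t.card ≃ t := t.equivFin.symm
  let f : approxLanguage.Functions t.card := ([], fun j => q (g j), m, false)
  let v : Fin t.card → X ⊕ K := fun j => Sum.inl (g j : X)
  have hex : ∃ b, ApproxEval φ f v b := by
    refine ⟨k, fun j a ha => ?_⟩
    obtain rfl : (g j : X) = a := Sum.inl_injective ha
    exact hq _
  have hmem := hG f v fun j => ht _ (g j).2
  have hval : (approxStructure φ F).funMap f v = Sum.inr hex.choose :=
    (if_neg Bool.false_ne_true).trans (dif_pos hex)
  rw [hval] at hmem
  refine ⟨_, hmem, fun a hat => ?_⟩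
  have h1 := hex.choose_spec (g.symm ⟨a, hat⟩) a (by simp [v])
  have h2 := hq a
  simp only [f, Equiv.apply_symm_apply] at h1
  rw [abs_lt] at *
  constructor <;> linarith [h1.1, h1.2, h2.1, h2.2]

/-- A point of `F s` which can be approximated on `B` from `A`, within every cylinder around `s`,
has the same values on `B` as some point of the closure of `A`. -/
theorem exists_mem_closure_eqOn [TopologicalSpace X] {φ : K → X → ℝ} (hφ : ∀ k, Continuous (φ k))
    {F : (ℕ → ℕ) → Set X} (hcomp : ∀ s, IsCompact (F s))
    (husc : ∀ s : ℕ → ℕ, ∀ W : Set X, IsOpen W → F s ⊆ W →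
      ∃ V : Set (ℕ → ℕ), IsOpen V ∧ s ∈ V ∧ ∀ s' ∈ V, F s' ⊆ W)
    {A : Set X} {B : Set K} {s : ℕ → ℕ} {x : X}
    (h : ∀ (N : ℕ) (t : Finset K), (∀ b ∈ t, b ∈ B) → ∀ ε : ℝ, 0 < ε →
      ∃ a ∈ A, a ∈ cylinderUnion F s N ∧ ∀ b ∈ t, |φ b a - φ b x| < ε) :
    ∃ x' ∈ closure A, ∀ b ∈ B, φ b x' = φ b x := by
  classical
  let S : ℕ × Finset B × ℕ → Set X := fun p =>
    {a | a ∈ A ∧ a ∈ cylinderUnion F s p.1 ∧ ∀ b ∈ p.2.1, |φ b a - φ b x| < 1 / ((p.2.2 : ℝ) + 1)}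
  have hSne (p) : (S p).Nonempty := by
    obtain ⟨a, ha, hc, hb⟩ := h p.1 (p.2.1.image Subtype.val)
      (fun b hb => by obtain ⟨c, -, rfl⟩ := Finset.mem_image.1 hb; exact c.2) _
      (Nat.one_div_pos_of_nat (α := ℝ) (n := p.2.2))
    exact ⟨a, ha, hc, fun b hbp => hb b (Finset.mem_image_of_mem _ hbp)⟩
  have hSanti : Antitone S := by
    rintro ⟨N, t, m⟩ ⟨N', t', m'⟩ ⟨hN, ht, hm⟩ a ⟨ha, ⟨w, hw, haw⟩, hb⟩
    exact ⟨ha, ⟨w, fun i hi => hw i (hi.trans_le hN), haw⟩, fun b hbt =>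
      (hb b (ht hbt)).trans_le (Nat.one_div_le_one_div hm)⟩
  let l : Filter X := ⨅ p, Filter.principal (S p)
  have hdir : Directed (· ≥ ·) fun p => Filter.principal (S p) := by
    intro p q
    exact ⟨p ⊔ q, Filter.principal_mono.2 (hSanti le_sup_left),
      Filter.principal_mono.2 (hSanti le_sup_right)⟩
  have hmem (p) : S p ∈ l := Filter.mem_iInf_of_mem p (Filter.mem_principal_self _)
  have hl : l.NeBot :=
    Filter.iInf_neBot_of_directed' hdir fun p => Filter.principal_neBot_iff.2 (hSne p)
  have hle : l ≤ 𝓝ˢ (F s) := by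
    intro W hW
    obtain ⟨O, hO, hFO, hOW⟩ := mem_nhdsSet_iff_exists.1 hW
    obtain ⟨V, hV, hsV, hVO⟩ := husc s O hO hFO
    obtain ⟨_, ⟨w₀, N, rfl⟩, hsN, hN⟩ :=
      (PiNat.isTopologicalBasis_cylinders fun _ : ℕ => ℕ).exists_subset_of_mem_open hsV hV
    rw [← PiNat.mem_cylinder_iff_eq.1 hsN] at hN
    refine Filter.mem_of_superset (hmem (N, ∅, 0)) ?_
    rintro a ⟨-, ⟨w, hw, haw⟩, -⟩
    exact hOW (hVO w (hN hw) haw)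
  have hnd : ¬ Disjoint (𝓝ˢ (F s)) l := fun hd => hl.ne (hd.eq_bot_of_ge hle)
  rw [(hcomp s).disjoint_nhdsSet_left] at hnd
  push Not at hnd
  obtain ⟨x', -, hx'⟩ := hnd
  have hne : (𝓝 x' ⊓ l).NeBot := ⟨fun hbot => hx' (disjoint_iff.2 hbot)⟩
  refine ⟨x', ?_, fun b hb => ?_⟩
  · rw [mem_closure_iff_clusterPt]
    refine hne.mono (inf_le_inf_left _ (Filter.le_principal_iff.2 ?_))
    exact Filter.mem_of_superset (hmem (0, ∅, 0)) fun a ha => ha.1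
  · have h1 : Filter.Tendsto (φ b) (𝓝 x' ⊓ l) (𝓝 (φ b x')) :=
      (hφ b).continuousAt.mono_left inf_le_left
    have h2 : Filter.Tendsto (φ b) (𝓝 x' ⊓ l) (𝓝 (φ b x)) := by
      rw [Metric.tendsto_nhds]
      intro ε hε
      obtain ⟨m, hm⟩ := exists_nat_one_div_lt hε
      refine Filter.mem_inf_of_right (Filter.mem_of_superset (hmem (0, {⟨b, hb⟩}, m)) ?_)
      rintro a ⟨-, -, ha⟩
      exact (ha ⟨b, hb⟩ (Finset.mem_singleton_self _)).trans hm
    exact tendsto_nhds_unique h1 h2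

variable [TopologicalSpace K]

theorem exists_mem_closure_eqOn_of_compact [CompactSpace K] {φ : K → X → ℝ}
    (hφ : ∀ x, Continuous fun k => φ k x) {A : Set X} {B : Set K} {k : K}
    (h : ∀ t : Finset X, (∀ a ∈ t, a ∈ A) → ∀ ε : ℝ, 0 < ε →
      ∃ b ∈ B, ∀ a ∈ t, |φ b a - φ k a| < ε) :
    ∃ k' ∈ closure B, ∀ a ∈ A, φ k' a = φ k a := by
  obtain ⟨k', hk', hA⟩ := exists_mem_closure_eqOn (X := K) (K := X) (φ := fun x k => φ k x) hφ
    (F := fun _ => Set.univ) (fun _ => isCompact_univ)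
    (fun s W _ hW => ⟨Set.univ, isOpen_univ, mem_univ s, fun _ _ => hW⟩) (A := B) (B := A) (s := 0)
    (x := k) (fun N t ht ε hε => by
      obtain ⟨b, hb, hbt⟩ := h t ht ε hε
      exact ⟨b, hb, ⟨0, fun _ _ => rfl, mem_univ b⟩, hbt⟩)
  exact ⟨k', hk', hA⟩

variable [TopologicalSpace X]

open FirstOrder.Language in
theorem exists_retractionSystem [Nonempty X] [CompactSpace K] {φ : K → X → ℝ}
    (hemb : IsEmbedding fun x k => φ k x) (hleft : ∀ x, Continuous fun k => φ k x)
    (hX : IsKAnalytic X) : ∃ R : RetractionSystem φ (X ⊕ K), R.A Set.univ = Set.univ := by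
  obtain ⟨F, hF, husc, hcov⟩ := hX
  let _ : approxLanguage.Structure (X ⊕ K) := approxStructure φ F
  let cl : Set (X ⊕ K) → Set (X ⊕ K) := fun T => Substructure.closure approxLanguage T
  have hmono : Monotone cl := fun S T h => Substructure.closure_mono h
  have hfun (T : Set (X ⊕ K)) {n} (f : approxLanguage.Functions n) (v : Fin n → X ⊕ K)
      (hv : ∀ j, v j ∈ cl T) : (approxStructure φ F).funMap f v ∈ cl T :=
    (Substructure.closure approxLanguage T).fun_mem f v hv
  have hdir {𝒯 : Set (Set (X ⊕ K))} (hne : 𝒯.Nonempty) (hd : DirectedOn (· ⊆ ·) 𝒯) {z}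
      (hz : z ∈ cl (⋃₀ 𝒯)) : ∃ T ∈ 𝒯, z ∈ cl T := by
    have := hne.to_subtype
    have hz' : z ∈ Substructure.closure approxLanguage (⋃ T : 𝒯, (T : Set (X ⊕ K))) := by
      rwa [← sUnion_eq_iUnion]
    rw [Substructure.closure_iUnion, Substructure.mem_iSup_of_directed] at hz'
    · obtain ⟨T, hT⟩ := hz'
      exact ⟨T, T.2, hT⟩
    · rintro ⟨S, hS⟩ ⟨T, hT⟩
      obtain ⟨W, hW, hSW, hTW⟩ := hd S hS T hT
      exact ⟨⟨W, hW⟩, hmono hSW, hmono hTW⟩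
  have hright (k : K) : Continuous (φ k) := (continuous_apply k).comp hemb.continuous
  have hr (T : Set (X ⊕ K)) (x : X) :
      ∃ x' ∈ closure (Sum.inl ⁻¹' cl T), ∀ b ∈ Sum.inr ⁻¹' cl T, φ b x' = φ b x := by
    obtain ⟨s, hs⟩ := mem_iUnion.1 (hcov ▸ mem_univ x : x ∈ ⋃ s, F s)
    exact exists_mem_closure_eqOn hright (fun s => (hF s).2) husc fun N t ht ε hε =>
      exists_approxPoint φ F (cl T) (hfun T) hs N t ht hε
  have hρ (T : Set (X ⊕ K)) (k : K) :
      ∃ k' ∈ closure (Sum.inr ⁻¹' cl T), ∀ a ∈ Sum.inl ⁻¹' cl T, φ k' a = φ k a :=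
    exists_mem_closure_eqOn_of_compact hleft fun t ht ε hε =>
      exists_approxEval φ F (cl T) (hfun T) k t ht hε
  choose r hrm hre using hr
  choose ρ hρm hρe using hρ
  refine ⟨{
    isEmbedding := hemb
    continuous_left := hleft
    A := fun T => Sum.inl ⁻¹' cl T
    B := fun T => Sum.inr ⁻¹' cl T
    A_mono := fun S T h => preimage_mono (hmono h)
    B_mono := fun S T h => preimage_mono (hmono h)
    exists_mem_A := fun hne hd _ ha => hdir hne hd ha
    exists_mem_B := fun hne hd _ hb => hdir hne hd hb
    countable_A := fun hT => by
      have := hT.substructure_closure approxLanguage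
      exact (to_countable (cl _)).preimage Sum.inl_injective
    r := r
    r_mem := hrm
    r_eq := hre
    ρ := ρ
    ρ_mem := hρm
    ρ_eq := hρe }, ?_⟩
  exact eq_univ_of_forall fun x => Substructure.subset_closure (mem_univ _)

end Closure

section Scattered

variable {X : Type u} [TopologicalSpace X]

theorem cbDeriv_antitone : Antitone (cbDeriv X : Ordinal.{u} → Set X) := by
  intro o o' h x hx
  rw [cbDeriv, mem_iInter] at hx ⊢
  exact fun p => hx ⟨p.1, p.2.trans_le h⟩

theorem IsScattered.exists_notMem_cbDeriv (h : IsScattered X) (x : X) :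
    ∃ o : Ordinal.{u}, x ∉ cbDeriv X o := by
  by_contra! hx
  let S : Set X := {y | ∀ o : Ordinal.{u}, y ∈ cbDeriv X o}
  obtain ⟨y, hy, U, hU, hUS⟩ := h S ⟨x, hx⟩
  have hex (z : X) : ∃ o : Ordinal.{u}, z ∉ S → z ∉ cbDeriv X o := by
    by_cases hz : z ∈ S
    · exact ⟨0, fun h => (h hz).elim⟩
    · obtain ⟨o, ho⟩ := not_forall.1 hz
      exact ⟨o, fun _ => ho⟩
  choose o ho using hex
  have hsup : cbDeriv X (⨆ z, o z) ⊆ S := by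
    intro z hz
    by_contra hzS
    exact ho z hzS (cbDeriv_antitone (Ordinal.le_iSup o z) hz)
  have hys := hy (Order.succ (⨆ z, o z))
  rw [cbDeriv, mem_iInter] at hys
  have hyc := (hys ⟨_, Order.lt_succ _⟩).2
  obtain ⟨z, hzU, hz, hzy⟩ := mem_closure_iff.1 hyc U hU (hUS ▸ mem_singleton y : y ∈ U ∩ S).1
  exact hzy (hUS ▸ ⟨hzU, hsup hz⟩ : z ∈ ({y} : Set X))

/-- Points of a scattered space have open neighbourhoods such that two distinct points never lie
in each other's neighbourhood. -/
theorem IsScattered.exists_separating_nhds (h : IsScattered X) :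
    ∃ U : X → Set X, (∀ x, IsOpen (U x) ∧ x ∈ U x) ∧ ∀ x y, y ∈ U x → x ∈ U y → x = y := by
  have hlevel (x : X) : ∃ b : Ordinal.{u}, x ∈ cbDeriv X b ∧ x ∉ closure (cbDeriv X b \ {x}) := by
    obtain ⟨o, ho, hmin⟩ := WellFounded.has_min (wellFounded_lt (α := Ordinal.{u}))
      {o | x ∉ cbDeriv X o} (h.exists_notMem_cbDeriv x)
    have ho' : x ∉ cbDeriv X o := ho
    rw [cbDeriv, mem_iInter, not_forall] at ho'
    obtain ⟨⟨b, hb⟩, hxb⟩ := ho'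
    have hmem : x ∈ cbDeriv X b := by
      by_contra hcon
      exact hmin b hcon hb
    exact ⟨b, hmem, fun hc => hxb ⟨hmem, hc⟩⟩
  choose b hb hbc using hlevel
  refine ⟨fun x => (closure (cbDeriv X (b x) \ {x}))ᶜ,
    fun x => ⟨isClosed_closure.isOpen_compl, hbc x⟩, fun x y hy hx => ?_⟩
  by_contra hne
  rcases le_total (b x) (b y) with hle | hle
  · exact hy (subset_closure ⟨cbDeriv_antitone hle (hb y), fun h => hne h.symm⟩)
  · exact hx (subset_closure ⟨cbDeriv_antitone hle (hb x), hne⟩)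

theorem IsScattered.countable_of_isCosmic (h : IsScattered X) (hc : IsCosmic X) :
    (Set.univ : Set X).Countable := by
  obtain ⟨N, hN, hnet⟩ := hc
  let W : Set X := ⋃₀ {s ∈ N | s.Countable}
  have hW : W.Countable := (hN.mono (sep_subset _ _)).sUnion fun s hs => hs.2
  suffices W = Set.univ from this ▸ hW
  by_contra hne
  obtain ⟨x, hx, U, hU, hUx⟩ := h Wᶜ (nonempty_compl.2 hne)
  have hUc : U.Countable := by
    refine (hW.union (countable_singleton x)).mono fun y hy => ?_
    by_cases hyW : y ∈ W
    · exact Or.inl hyW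
    · exact Or.inr (hUx ▸ ⟨hy, hyW⟩ : y ∈ ({x} : Set X))
  obtain ⟨s, hs, hxs, hsU⟩ := hnet x U hU (hUx ▸ mem_singleton x : x ∈ U ∩ Wᶜ).1
  exact hx ⟨s, ⟨hs, hUc.mono hsU⟩, hxs⟩

theorem isSigmaDiscrete_of_countable (h : (Set.univ : Set X).Countable) : IsSigmaDiscrete X := by
  rcases isEmpty_or_nonempty X with hX | hX
  · exact ⟨fun _ => ∅, Subsingleton.elim _ _, fun _ => inferInstance⟩
  have : Countable X := countable_univ_iff.1 h
  obtain ⟨f, hf⟩ := exists_surjective_nat X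
  refine ⟨fun n => {f n}, ?_, fun n => inferInstance⟩
  rw [iUnion_singleton_eq_range, hf.range_eq]

theorem RetractionSystem.HasNetwork.isSigmaDiscrete {K Z : Type*} [TopologicalSpace K]
    {φ : K → X → ℝ} {R : RetractionSystem φ Z} {T : Set Z} (hR : R.HasNetwork T)
    (hT : R.A T = Set.univ) (h : IsScattered X) : IsSigmaDiscrete X := by
  obtain ⟨U, hU, hsep⟩ := h.exists_separating_nhds
  obtain ⟨D, E, hE, hO, hD⟩ := hR
  refine ⟨fun n => {x ∈ D n | ∀ y ∈ D n, E n x y → y ∈ U x}, ?_, fun n => ?_⟩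
  · refine eq_univ_of_forall fun x => ?_
    have hnhds : U x ∈ 𝓝 x := (hU x).1.mem_nhds (hU x).2
    rw [R.isEmbedding.nhds_eq_comap, Filter.mem_comap] at hnhds
    obtain ⟨V, hV, hVU⟩ := hnhds
    obtain ⟨I, hI, ε, hε, hsub⟩ : ∃ I : Set K, I.Finite ∧ ∃ ε : ℝ, 0 < ε ∧
        ∀ y, (∀ k ∈ I, |φ k y - φ k x| < ε) → y ∈ U x := by
      rw [nhds_pi, Filter.mem_pi] at hV
      obtain ⟨I, hI, t, ht, htV⟩ := hV
      have hball (k : K) : ∃ ε : ℝ, 0 < ε ∧ Metric.ball (φ k x) ε ⊆ t k :=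
        Metric.mem_nhds_iff.1 (ht k)
      choose ε hε hεt using hball
      rcases I.eq_empty_or_nonempty with rfl | hne
      · exact ⟨∅, finite_empty, 1, one_pos, fun y _ => hVU (htV (by simp))⟩
      obtain ⟨k₀, -, hmin⟩ := exists_min_image I ε hI hne
      exact ⟨I, hI, ε k₀, hε k₀, fun y hy => hVU (htV fun k hk =>
        hεt k ((hy k hk).trans_le (hmin k hk)))⟩
    obtain ⟨n, hn, hclose⟩ := hD x (by simp [hT]) (ε / 2) (half_pos hε)
    exact mem_iUnion.2 ⟨n, hn, fun y hy hxy => hsub y fun k _ =>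
      (hclose y hy hxy k).trans_lt (half_lt_self hε)⟩
  · rw [discreteTopology_subtype_iff']
    rintro x ⟨hx, hxU⟩
    obtain ⟨O, hOo, hxO, hOE⟩ := hO n x hx
    refine ⟨O, hOo, eq_singleton_iff_unique_mem.2 ⟨⟨hxO, hx, hxU⟩, ?_⟩⟩
    rintro y ⟨hyO, hy, hyU⟩
    have hxy := hOE y hy hyO
    exact hsep y x (hyU x hx (hE _ _ _ hxy)) (hxU y hy hxy)

end Scattered

/-- Every Eberlein–Grothendieck scattered space that is K-analytic, as well as every
Eberlein–Grothendieck scattered space that is cosmic, is σ-discrete. -/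
theorem sigmaDiscrete_of_EG_scattered_kAnalytic_or_cosmic
    (X : Type u) [TopologicalSpace X]
    (hEG : EberleinGrothendieck X) (hsc : IsScattered X)
    (h : IsKAnalytic X ∨ IsCosmic X) :
    IsSigmaDiscrete X := by
  rcases h with h | h
  · rcases isEmpty_or_nonempty X with hX | hX
    · exact isSigmaDiscrete_of_countable (to_countable _)
    obtain ⟨K, _, _, _, f, hf⟩ := hEG
    obtain ⟨R, hR⟩ := exists_retractionSystem (φ := fun k x => (f x).1 k)
      (IsEmbedding.subtypeVal.comp hf) (fun x => (f x).2) h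
    exact (R.hasNetwork Set.univ).isSigmaDiscrete hR hsc
  · exact isSigmaDiscrete_of_countable (hsc.countable_of_isCosmic h)
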